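/- Let 0 → P →^{g} G →^{π} M → 0 and 0 → P' →^{g'} G' →^{π'} M' → 0 be exact sequences of S-modules with ω·M = 0 and ω·M' = 0, let f: M → M' be S-linear, and let φ1: P → P', φ0: G → G' satisfy g'∘φ1 = φ0∘g and π'∘φ0 = f∘π. Suppose there exist n ≥ 1 and S-linear maps h1: P → (S ⊕ S)^n, h0: G → (S ⊕ S)^n, h1': (S ⊕ S)^n → P', h0': (S ⊕ S)^n → G' with d∘h1 = h0∘g, g'∘h1' = h0'∘d, φ1 = h1'∘h1 and φ0 = h0'∘h0, where d = (ω ⊕ id)^{⊕n}: (S ⊕ S)^n → (S ⊕ S)^n. Then f factors through the finitely generated free R-module R^n; i.e. there exist R-linear maps l: M → R^n and l': R^n → M' with f = l'∘l. -/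

import Mathlib

open CategoryTheory LinearMap Function

/-- A module `M` over a commutative ring `A` is *Gorenstein projective* if the biduality
map `M → Hom_A(Hom_A(M,A),A)` is an isomorphism and
`Ext^i_A(M,A) = 0 = Ext^i_A(Hom_A(M,A),A)` for all `i ≥ 1`. -/
noncomputable def IsGP (A : Type) [CommRing A] (M : Type) [AddCommGroup M] [Module A M] : Prop :=
  Function.Bijective (Module.Dual.eval A M) ∧
  (∀ i : ℕ, 0 < i →
    Subsingleton (((Ext A (ModuleCat A) i).obj
      (Opposite.op (ModuleCat.of A M))).obj (ModuleCat.of A A))) ∧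
  (∀ i : ℕ, 0 < i →
    Subsingleton (((Ext A (ModuleCat A) i).obj
      (Opposite.op (ModuleCat.of A (Module.Dual A M)))).obj (ModuleCat.of A A)))

/-- `f : G1 → G0` is an object of the monomorphism category `Mon(ω, 𝒢)`:
`G1`, `G0` are finitely generated Gorenstein projective `S`-modules, `f` is injective,
and `ω · Coker f = 0` (i.e. `ω • y ∈ range f` for all `y`). -/
def MonObj (S : Type) [CommRing S] (ω : S) {G1 G0 : Type}
    [AddCommGroup G1] [Module S G1] [AddCommGroup G0] [Module S G0]
    (f : G1 →ₗ[S] G0) : Prop :=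
  Module.Finite S G1 ∧ Module.Finite S G0 ∧ IsGP S G1 ∧ IsGP S G0 ∧
  Function.Injective f ∧ ∀ y : G0, ω • y ∈ LinearMap.range f

/-- The map `(ω ⊕ id)^{⊕ n} : (S ⊕ S)^n → (S ⊕ S)^n`. -/
noncomputable def dPow (S : Type) [CommRing S] (ω : S) (n : ℕ) :
    (Fin n → S × S) →ₗ[S] (Fin n → S × S) :=
  LinearMap.pi fun i =>
    ((ω • (LinearMap.id : S →ₗ[S] S)).prodMap (LinearMap.id : S →ₗ[S] S)) ∘ₗ
      LinearMap.proj i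

/-- if a lift `(φ1, φ0)` of `f : M → M'` between two short exact sequences
(with `ω·M = 0 = ω·M'`) factors through `((ω ⊕ id)^{⊕n} : (S ⊕ S)^n → (S ⊕ S)^n)`,
then `f` factors through the finitely generated free `R`-module `R^n`. -/
theorem stmt_14 (S : Type) [CommRing S] [IsNoetherianRing S] [IsLocalRing S]
    (ω : S) (hω : ω ∈ IsLocalRing.maximalIdeal S) (hreg : ω ∈ nonZeroDivisors S)
    (P G M P' G' M' : Type)
    [AddCommGroup P] [Module S P] [AddCommGroup G] [Module S G]
    [AddCommGroup M] [Module S M] [AddCommGroup P'] [Module S P']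
    [AddCommGroup G'] [Module S G'] [AddCommGroup M'] [Module S M']
    [Module (S ⧸ Ideal.span {ω}) M] [IsScalarTower S (S ⧸ Ideal.span {ω}) M]
    [Module (S ⧸ Ideal.span {ω}) M'] [IsScalarTower S (S ⧸ Ideal.span {ω}) M']
    [Module.Finite S P] [Module.Finite S G] [Module.Finite S M]
    [Module.Finite S P'] [Module.Finite S G'] [Module.Finite S M']
    (g : P →ₗ[S] G) (π : G →ₗ[S] M) (g' : P' →ₗ[S] G') (π' : G' →ₗ[S] M')
    (hg : Function.Injective g) (hgπ : Function.Exact g π)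
    (hπ : Function.Surjective π)
    (hg' : Function.Injective g') (hg'π' : Function.Exact g' π')
    (hπ' : Function.Surjective π')
    (hM : ∀ m : M, ω • m = 0) (hM' : ∀ m : M', ω • m = 0)
    (f : M →ₗ[S] M')
    (φ1 : P →ₗ[S] P') (φ0 : G →ₗ[S] G')
    (hc1 : g' ∘ₗ φ1 = φ0 ∘ₗ g) (hc2 : π' ∘ₗ φ0 = f ∘ₗ π)
    (n : ℕ) (hn : 1 ≤ n)
    (h1 : P →ₗ[S] (Fin n → S × S)) (h0 : G →ₗ[S] (Fin n → S × S))
    (h1' : (Fin n → S × S) →ₗ[S] P') (h0' : (Fin n → S × S) →ₗ[S] G')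
    (hd1 : dPow S ω n ∘ₗ h1 = h0 ∘ₗ g) (hd2 : g' ∘ₗ h1' = h0' ∘ₗ dPow S ω n)
    (hf1 : φ1 = h1' ∘ₗ h1) (hf0 : φ0 = h0' ∘ₗ h0) :
    ∃ (l : M →ₗ[S ⧸ Ideal.span {ω}] (Fin n → S ⧸ Ideal.span {ω}))
      (l' : (Fin n → S ⧸ Ideal.span {ω}) →ₗ[S ⧸ Ideal.span {ω}] M'),
      f = LinearMap.restrictScalars S (l' ∘ₗ l) := by
  have hR : Function.Surjective (algebraMap S (S ⧸ Ideal.span {ω})) := Ideal.Quotient.mk_surjective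
  let q : (Fin n → S × S) →ₗ[S] (Fin n → S ⧸ Ideal.span {ω}) :=
    LinearMap.pi fun i => (Algebra.linearMap S (S ⧸ Ideal.span {ω})) ∘ₗ LinearMap.fst S S S ∘ₗ
      LinearMap.proj i
  have hq : ∀ x i, q x i = algebraMap S (S ⧸ Ideal.span {ω}) (x i).1 := fun x i => rfl
  have hqd : ∀ x, q (dPow S ω n x) = 0 := by
    intro x
    ext i
    rw [hq]
    have : ((dPow S ω n x) i).1 = ω * (x i).1 := rfl
    rw [this]
    exact Ideal.Quotient.eq_zero_iff_mem.mpr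
      (Ideal.mul_mem_right _ _ (Ideal.mem_span_singleton_self ω))
  have hker : LinearMap.ker π ≤ LinearMap.ker (q ∘ₗ h0) := by
    intro y hy
    obtain ⟨p, rfl⟩ := (hgπ y).1 hy
    have := LinearMap.congr_fun hd1 p
    simp only [LinearMap.comp_apply] at this
    simp only [LinearMap.mem_ker, LinearMap.comp_apply]
    rw [← this, hqd]
  let l0 : M →ₗ[S] (Fin n → S ⧸ Ideal.span {ω}) :=
    (LinearMap.ker π).liftQ (q ∘ₗ h0) hker ∘ₗ (π.quotKerEquivOfSurjective hπ).symm.toLinearMap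
  have hl0 : ∀ y, l0 (π y) = q (h0 y) := by
    intro y
    have : (π.quotKerEquivOfSurjective hπ).symm (π y) = Submodule.Quotient.mk y := by
      rw [LinearEquiv.symm_apply_eq]; rfl
    simp only [l0, LinearMap.comp_apply, LinearEquiv.coe_coe]
    rw [this]; rfl
  refine ⟨LinearMap.extendScalarsOfSurjective hR l0,
    Fintype.linearCombination (S ⧸ Ideal.span {ω})
      (fun i => π' (h0' (Pi.single i (1, 0)))), ?_⟩
  ext m
  obtain ⟨y, rfl⟩ := hπ m
  have e1 : f (π y) = π' (h0' (h0 y)) := by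
    have := LinearMap.congr_fun hc2 y
    rw [hf0] at this
    exact this.symm
  have key : ∀ x, π' (h0' x) = ∑ i, (x i).1 • π' (h0' (Pi.single i (1, 0))) := by
    intro x
    have hx : x = dPow S ω n (fun i => (0, (x i).2)) + ∑ i, (x i).1 • Pi.single i ((1 : S), (0 : S)) := by
      ext j
      · simp [dPow, Finset.sum_apply, Pi.single_apply, Prod.fst_sum, apply_ite Prod.fst]
      · simp [dPow, Finset.sum_apply, Pi.single_apply, Prod.snd_sum, apply_ite Prod.snd]
    have hz : ∀ z, π' (h0' (dPow S ω n z)) = 0 := by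
      intro z
      have := LinearMap.congr_fun hd2 z
      simp only [LinearMap.comp_apply] at this
      rw [← this]
      exact (hg'π' _).2 ⟨_, rfl⟩
    conv_lhs => rw [hx]
    simp only [map_add, map_sum, map_smul, hz, zero_add]
  rw [e1, key]
  change _ = Fintype.linearCombination _ _ (l0 (π y))
  rw [hl0, Fintype.linearCombination_apply]
  refine Finset.sum_congr rfl fun i _ => ?_
  rw [hq, algebraMap_smul]
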